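/- Let L₁, L be real numbers with 0 < L₁ ≤ L/2, set α := L₁/L and suppose α is irrational; define ξ_n = 2|αn − ⌊αn + 1/2⌋|. Let (ω_n)_{n≥1} be a sequence of negative reals such that for every n ≥ 1 there exists k ∈ (1/√2, 1) with S(k) = L·√(−ω_n)/n and φ(k) = 1 − ξ_n. Then the sequence (√(−ω_n))_{n≥1} is unbounded; in particular (ω_n) is not bounded below. -/

import Mathlib

open Real Filter Set

/-- Complete elliptic integral of the first kind. -/
noncomputable def Kell (k : ℝ) : ℝ :=
  ∫ t in (0:ℝ)..1, 1 / Real.sqrt ((1 - t^2) * (1 - k^2 * t^2))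

/-- S(k) = 4√(2k²−1)·K(k). -/
noncomputable def Sfun (k : ℝ) : ℝ := 4 * Real.sqrt (2 * k^2 - 1) * Kell k

/-- H(k), the numerator in the definition of φ. -/
noncomputable def Hfun (k : ℝ) : ℝ :=
  ∫ t in Real.sqrt ((2 * k^2 - 1) / k^2)..1,
    1 / Real.sqrt ((1 - t^2) * (1 - k^2 * (1 - t^2)))

/-- φ(k) = H(k)/K(k). -/
noncomputable def phiFun (k : ℝ) : ℝ := Hfun k / Kell k

/-- ξ_n = 2|αn − ⌊αn + 1/2⌋|. -/
noncomputable def xiSeq (α : ℝ) (n : ℕ) : ℝ :=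
  2 * |α * n - (⌊α * n + 1/2⌋ : ℝ)|

open MeasureTheory intervalIntegral in
/-- Comparison of a weighted integral of `1 / √(1 - t²)` with the arccosine. -/
theorem arccos_le_integral_le_arccos_div_sqrt {w : ℝ → ℝ} (hw : Continuous w) {a c : ℝ}
    (ha : 0 ≤ a) (ha1 : a ≤ 1) (hc : 0 < c) (hcw : ∀ t ∈ Icc a 1, c ≤ w t)
    (hw1 : ∀ t ∈ Icc a 1, w t ≤ 1) :
    Real.arccos a ≤ (∫ t in a..1, 1 / √((1 - t ^ 2) * w t)) ∧
      (∫ t in a..1, 1 / √((1 - t ^ 2) * w t)) ≤ Real.arccos a / √c := by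
  have hderiv : ∀ t ∈ Ioo a 1, HasDerivAt Real.arcsin (1 / √(1 - t ^ 2)) t := fun t ht =>
    Real.hasDerivAt_arcsin (by linarith [ht.1]) ht.2.ne
  have hint : IntervalIntegrable (fun t : ℝ => 1 / √(1 - t ^ 2)) volume a 1 := by
    refine intervalIntegrable_deriv_of_nonneg (g := Real.arcsin)
      Real.continuous_arcsin.continuousOn ?_ (fun t _ => by positivity)
    rwa [min_eq_left ha1, max_eq_right ha1]
  have hval : (∫ t in a..1, 1 / √(1 - t ^ 2)) = Real.arccos a := by
    rw [integral_eq_sub_of_hasDerivAt_of_le ha1 Real.continuous_arcsin.continuousOn hderiv hint,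
      Real.arcsin_one, Real.arccos]
  have hsq : ∀ t ∈ Icc a 1, 0 ≤ 1 - t ^ 2 := fun t ht => by nlinarith [ht.1, ht.2]
  have hlower : ∀ t ∈ Icc a 1, 1 / √(1 - t ^ 2) ≤ 1 / √((1 - t ^ 2) * w t) := by
    intro t ht
    rcases (hsq t ht).eq_or_lt with h | h
    · simp [← h]
    · have := hc.trans_le (hcw t ht)
      gcongr
      exact mul_le_of_le_one_right h.le (hw1 t ht)
  have hupper : ∀ t ∈ Icc a 1, 1 / √((1 - t ^ 2) * w t) ≤ 1 / √(1 - t ^ 2) / √c := by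
    intro t ht
    rw [div_div, Real.sqrt_mul (hsq t ht)]
    rcases (hsq t ht).eq_or_lt with h | h
    · simp [← h]
    · have := hcw t ht
      gcongr
  have hint' : IntervalIntegrable (fun t : ℝ => 1 / √((1 - t ^ 2) * w t)) volume a 1 := by
    refine (hint.div_const √c).mono_fun' (Measurable.aestronglyMeasurable ?_) ?_
    · have := hw.measurable
      fun_prop
    · rw [Filter.EventuallyLE, ae_restrict_iff' measurableSet_uIoc]
      refine Filter.Eventually.of_forall fun t ht => ?_
      rw [uIoc_of_le ha1] at ht
      rw [Real.norm_of_nonneg (by positivity)]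
      exact hupper t (Ioc_subset_Icc_self ht)
  constructor
  · rw [← hval]
    exact integral_mono_on ha1 hint hint' hlower
  · rw [← hval, ← intervalIntegral.integral_div]
    exact integral_mono_on ha1 hint' (hint.div_const _) hupper

theorem pi_div_two_le_Kell {k : ℝ} (hk : k ^ 2 < 1) : π / 2 ≤ Kell k := by
  have := (arccos_le_integral_le_arccos_div_sqrt (w := fun t => 1 - k ^ 2 * t ^ 2)
    (by fun_prop) le_rfl zero_le_one (c := 1 - k ^ 2) (by linarith)
    (fun t ht => by
      nlinarith [mul_nonneg (sq_nonneg k) (by nlinarith [ht.1, ht.2] : 0 ≤ 1 - t ^ 2)])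
    (fun t ht => by nlinarith [sq_nonneg (k * t)])).1
  rwa [Real.arccos_zero] at this

theorem Kell_le {k : ℝ} (hk : k ^ 2 < 1) : Kell k ≤ π / 2 / √(1 - k ^ 2) := by
  have := (arccos_le_integral_le_arccos_div_sqrt (w := fun t => 1 - k ^ 2 * t ^ 2)
    (by fun_prop) le_rfl zero_le_one (c := 1 - k ^ 2) (by linarith)
    (fun t ht => by
      nlinarith [mul_nonneg (sq_nonneg k) (by nlinarith [ht.1, ht.2] : 0 ≤ 1 - t ^ 2)])
    (fun t ht => by nlinarith [sq_nonneg (k * t)])).2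
  rwa [Real.arccos_zero] at this

theorem arccos_le_Hfun {k : ℝ} (hk : k ^ 2 < 1) :
    Real.arccos √((2 * k ^ 2 - 1) / k ^ 2) ≤ Hfun k := by
  have hle : √((2 * k ^ 2 - 1) / k ^ 2) ≤ 1 := by
    rw [Real.sqrt_le_one]
    exact div_le_one_of_le₀ (by linarith) (sq_nonneg k)
  refine (arccos_le_integral_le_arccos_div_sqrt (w := fun t => 1 - k ^ 2 * (1 - t ^ 2))
    (by fun_prop) (Real.sqrt_nonneg _) hle (c := 1 - k ^ 2) (by linarith)
    (fun t ht => by nlinarith [sq_nonneg (k * t)]) (fun t ht => ?_)).1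
  have : 0 ≤ t := (Real.sqrt_nonneg _).trans ht.1
  nlinarith [mul_nonneg (sq_nonneg k) (by nlinarith [ht.2] : 0 ≤ 1 - t ^ 2)]

theorem arcsin_le_pi_div_two_mul {a : ℝ} (ha : 0 ≤ a) (ha1 : a ≤ 1) :
    Real.arcsin a ≤ π / 2 * a := by
  have h := Real.mul_le_sin (Real.arcsin_nonneg.2 ha) (Real.arcsin_le_pi_div_two a)
  rw [Real.sin_arcsin (by linarith) ha1] at h
  calc Real.arcsin a = π / 2 * (2 / π * Real.arcsin a) := by
        field_simp
    _ ≤ π / 2 * a := by gcongr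

/-- `φ` exceeds `1/2` for moduli close to `1/√2`. -/
theorem half_lt_phiFun {k : ℝ} (hk : 1 < 2 * k ^ 2) (hk' : 2 * k ^ 2 ≤ 1 + 1 / 100) :
    1 / 2 < phiFun k := by
  have hk1 : k ^ 2 < 1 := by linarith
  have hK : 0 < Kell k := lt_of_lt_of_le (by positivity) (pi_div_two_le_Kell hk1)
  have ha : √((2 * k ^ 2 - 1) / k ^ 2) ≤ 15 / 100 := by
    rw [Real.sqrt_le_left (by norm_num), div_le_iff₀ (by linarith)]
    linarith
  have hs : 7 / 10 ≤ √(1 - k ^ 2) := Real.le_sqrt_of_sq_le (by linarith)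
  have hH := arccos_le_Hfun hk1
  have hasin := arcsin_le_pi_div_two_mul (Real.sqrt_nonneg ((2 * k ^ 2 - 1) / k ^ 2))
    (by linarith)
  rw [Real.arccos] at hH
  have hK' : Kell k ≤ π / 2 / (7 / 10) := (Kell_le hk1).trans (by gcongr)
  rw [phiFun, lt_div_iff₀ hK]
  nlinarith [Real.pi_pos]

theorem two_fifths_le_Sfun {k : ℝ} (hk1 : k ^ 2 < 1) (hk : 1 + 1 / 100 ≤ 2 * k ^ 2) :
    2 / 5 ≤ Sfun k := by
  have hs : 1 / 10 ≤ √(2 * k ^ 2 - 1) := Real.le_sqrt_of_sq_le (by linarith)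
  have hK : 1 ≤ Kell k := by linarith [pi_div_two_le_Kell hk1, Real.pi_gt_three]
  rw [Sfun]
  nlinarith

theorem xiSeq_eq (α : ℝ) (n : ℕ) : xiSeq α n = 2 * |α * n - round (α * n)| := by
  rw [xiSeq, round_eq]

theorem abs_sub_round_two_mul {x : ℝ} (hx : |x - round x| < 1 / 4)
    (hx' : |2 * x - round (2 * x)| < 1 / 4) :
    |2 * x - round (2 * x)| = 2 * |x - round x| := by
  have hr : round (2 * x) = 2 * round x := by
    rw [abs_lt] at hx hx'
    have h1 : ((round (2 * x) : ℤ) : ℝ) < ((2 * round x + 1 : ℤ) : ℝ) := by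
      push_cast
      linarith
    have h2 : ((2 * round x - 1 : ℤ) : ℝ) < ((round (2 * x) : ℤ) : ℝ) := by
      push_cast
      linarith
    have := Int.cast_lt.1 h1
    have := Int.cast_lt.1 h2
    omega
  rw [hr]
  push_cast
  rw [← mul_sub, abs_mul, abs_two]

/-- Doubling an irrational repeatedly moves it away from the integers. -/
theorem Irrational.exists_two_pow_mul_abs_sub_round {x : ℝ} (hx : Irrational x) :
    ∃ j : ℕ, 1 / 4 ≤ |2 ^ j * x - round (2 ^ j * x)| := by
  by_contra! h
  have hd : ∀ j : ℕ, |2 ^ j * x - round (2 ^ j * x)| = 2 ^ j * |x - round x| := by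
    intro j
    induction j with
    | zero => simp
    | succ j ih =>
      have h' := h (j + 1)
      rw [pow_succ', mul_assoc] at h' ⊢
      rw [abs_sub_round_two_mul (h j) h', ih, mul_assoc]
  have hpos : 0 < |x - round x| := abs_pos.2 (sub_ne_zero.2 (hx.ne_int _))
  obtain ⟨j, hj⟩ := pow_unbounded_of_one_lt (1 / 4 / |x - round x|) (one_lt_two (α := ℝ))
  rw [div_lt_iff₀ hpos, ← hd j] at hj
  exact lt_asymm hj (h j)

theorem Irrational.exists_ge_half_le_xiSeq {α : ℝ} (hα : Irrational α) {N : ℕ} (hN : 1 ≤ N) :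
    ∃ n ≥ N, 1 / 2 ≤ xiSeq α n := by
  obtain ⟨j, hj⟩ := (hα.mul_natCast (by omega : N ≠ 0)).exists_two_pow_mul_abs_sub_round
  refine ⟨2 ^ j * N, Nat.le_mul_of_pos_left N (by positivity), ?_⟩
  rw [xiSeq_eq]
  push_cast
  rw [mul_left_comm]
  linarith


/-- with α = L₁/L irrational, the frequencies ω_n determined by
S(k) = L√(−ω_n)/n, φ(k) = 1 − ξ_n give an unbounded sequence √(−ω_n); in
particular (ω_n) is not bounded below. -/
theorem stmt_9 (L₁ L α : ℝ) (hL₁ : 0 < L₁) (hL : L₁ ≤ L / 2)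
    (hα : α = L₁ / L) (hirr : Irrational α)
    (ω : ℕ → ℝ) (hω : ∀ n : ℕ, 1 ≤ n → ω n < 0)
    (hk : ∀ n : ℕ, 1 ≤ n → ∃ k ∈ Set.Ioo (1 / Real.sqrt 2) 1,
      Sfun k = L * Real.sqrt (-(ω n)) / n ∧ phiFun k = 1 - xiSeq α n) :
    (∀ M : ℝ, ∃ n : ℕ, 1 ≤ n ∧ M < Real.sqrt (-(ω n))) ∧
    (∀ M : ℝ, ∃ n : ℕ, 1 ≤ n ∧ ω n < M) := by
  have hL0 : 0 < L := by linarith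
  have key : ∀ M : ℝ, ∃ n : ℕ, 1 ≤ n ∧ M < √(-(ω n)) := by
    intro M
    obtain ⟨N, hN⟩ := exists_nat_gt (5 / 2 * L * M)
    obtain ⟨n, hn, hxi⟩ := hirr.exists_ge_half_le_xiSeq (Nat.le_add_left 1 N)
    have hn1 : 1 ≤ n := by omega
    obtain ⟨k, ⟨hk0, hk1⟩, hS, hphi⟩ := hk n hn1
    have hkpos : 0 < k := lt_trans (by positivity) hk0
    have hksq : k ^ 2 < 1 := by nlinarith
    have hk2 : 1 < 2 * k ^ 2 := by
      rw [one_div, ← Real.sqrt_inv, Real.sqrt_lt' hkpos] at hk0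
      linarith
    have hk3 : 1 + 1 / 100 ≤ 2 * k ^ 2 := by
      by_contra! h
      linarith [half_lt_phiFun hk2 h.le]
    have hS' := two_fifths_le_Sfun hksq hk3
    have hnpos : (0 : ℝ) < n := by exact_mod_cast hn1
    have hNn : (N : ℝ) ≤ n := by exact_mod_cast (by omega : N ≤ n)
    rw [hS, le_div_iff₀ hnpos] at hS'
    refine ⟨n, hn1, lt_of_mul_lt_mul_left ?_ hL0.le⟩
    linarith
  refine ⟨key, fun M => ?_⟩
  obtain ⟨n, hn, h⟩ := key (|M| + 1)
  refine ⟨n, hn, ?_⟩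
  have hsq := Real.sq_sqrt (neg_nonneg.2 (hω n hn).le)
  nlinarith [abs_nonneg M, neg_abs_le M]
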